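/- Let (R, 𝔪) be a Noetherian local ring of dimension 1 with infinite residue field, and let 𝔮 = (x) be a standard parameter ideal of R such that I² = 𝔮I, where I = 𝔮 :_R 𝔪, and such that 𝒩(𝔮;R) = r₀(R) + r₁(R). Then e₁(I) − e₁(𝔮) = f₀(𝔮) − r₀(R), where r₀(R) = ℓ_R((0) :_R 𝔪). -/

import Mathlib

open CategoryTheory IsLocalRing

noncomputable section

/-- The length of a module, defined as the Krull dimension of its submodule lattice. -/
def moduleLength (R M : Type) [CommRing R] [AddCommGroup M] [Module R M] : WithBot ℕ∞ :=
  Order.krullDim (Submodule R M)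

variable (R : Type) [CommRing R] [IsLocalRing R]

/-- `q` is a parameter ideal of the `d`-dimensional local ring `R`:
it is generated by `d` elements and is `𝔪`-primary (its radical is `𝔪`). -/
def IsParameterIdeal (d : ℕ) (q : Ideal R) : Prop :=
  (∃ x : Fin d → R, q = Ideal.span (Set.range x)) ∧ q.radical = maximalIdeal R

/-- `e` is the sequence of Hilbert coefficients of the `𝔪`-primary ideal `I`:
for all large `n`, `ℓ(R/Iⁿ⁺¹) = Σ_{i=0}^d (-1)^i e_i C(n+d-i, d-i)`. -/
def IsHilbertCoeffs (d : ℕ) (I : Ideal R) (e : ℕ → ℤ) : Prop :=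
  ∃ N : ℕ, ∀ n ≥ N, ∃ L : ℕ,
    moduleLength R (R ⧸ I ^ (n + 1)) = (L : ℕ∞) ∧
    (L : ℤ) = ∑ i ∈ Finset.range (d + 1),
      (-1 : ℤ) ^ i * e i * ((n + d - i).choose (d - i) : ℤ)

/-- The index of reducibility `𝒩(q;R) = ℓ_R((q :_R 𝔪)/q)`. -/
def indexOfReducibility (q : Ideal R) : WithBot ℕ∞ :=
  moduleLength R
    (↥(q.colon (maximalIdeal R)) ⧸ (Submodule.comap (q.colon (maximalIdeal R)).subtype q))

/-- `R` is unmixed of dimension `d`: `dim (R̂/P) = d` for every associated prime `P`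
of the `𝔪`-adic completion `R̂` of `R`. -/
def IsUnmixed (d : ℕ) : Prop :=
  ∀ P ∈ associatedPrimes (AdicCompletion (maximalIdeal R) R) (AdicCompletion (maximalIdeal R) R),
    ringKrullDim ((AdicCompletion (maximalIdeal R) R) ⧸ P) = (d : WithBot ℕ∞)

/-- The depth of a local ring `A`, as the least `i` such that `Ext^i(k, A) ≠ 0`. -/
def extDepth (A : Type) [CommRing A] [IsLocalRing A] : ℕ∞ :=
  sInf {n : ℕ∞ | ∃ m : ℕ, n = (m : ℕ∞) ∧
    Nontrivial (((Ext A (ModuleCat A) m).obj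
      (Opposite.op (ModuleCat.of A (ResidueField A)))).obj (ModuleCat.of A A))}

/-- A local ring is Cohen–Macaulay if its depth equals its Krull dimension. -/
def IsCohenMacaulay (A : Type) [CommRing A] [IsLocalRing A] : Prop :=
  (extDepth A : WithBot ℕ∞) = ringKrullDim A

/-- The Cohen–Macaulay type `r(R) = ℓ_R(Ext^d_R(R/𝔪, R))`. -/
def cmType (d : ℕ) : WithBot ℕ∞ :=
  moduleLength R (((Ext R (ModuleCat R) d).obj
      (Opposite.op (ModuleCat.of R (R ⧸ maximalIdeal R)))).obj (ModuleCat.of R R))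

/-- `f` is the sequence of coefficients of the polynomial that agrees with
`n ↦ ℓ((Iⁿ :_R 𝔪)/Iⁿ)` for all large `n`; `f 0` is the irreducible multiplicity `f₀(I)`. -/
def IsIrrCoeffs (d : ℕ) (I : Ideal R) (f : ℕ → ℤ) : Prop :=
  ∃ N : ℕ, ∀ n ≥ N, ∃ L : ℕ,
    indexOfReducibility R (I ^ n) = (L : ℕ∞) ∧
    (L : ℤ) = ∑ i ∈ Finset.range d,
      (-1 : ℤ) ^ i * f i * ((n + (d - 1) - i).choose (d - 1 - i) : ℤ)

/-- `R` is a generalized Cohen–Macaulay ring of dimension `d`: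
the local cohomology modules `H^i_𝔪(R)` have finite length for all `i < d`. -/
def IsGeneralizedCM (d : ℕ) : Prop :=
  ∀ i < d, ∃ L : ℕ,
    moduleLength R ↥((localCohomology (maximalIdeal R) i).obj (ModuleCat.of R R)) = (L : ℕ∞)

/-- `r_i(R) = dim_k ((0) :_{H^i_𝔪(R)} 𝔪)`, the length of the socle of the `i`-th
local cohomology module of `R`. -/
def socLocalCohomology (i : ℕ) : WithBot ℕ∞ :=
  moduleLength R
    ↥(Submodule.torsionBySet R ↥((localCohomology (maximalIdeal R) i).obj (ModuleCat.of R R))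
      (maximalIdeal R : Set R))

/-- A system of parameters `x₁, …, x_d` is standard if
`𝔮·H^i_𝔪(R/(x₁,…,x_j)R) = 0` for all `i + j < d`, where `𝔮 = (x₁,…,x_d)`. -/
def IsStandardSOP (d : ℕ) (x : Fin d → R) : Prop :=
  (Ideal.span (Set.range x)).radical = maximalIdeal R ∧
  ∀ i j : ℕ, i + j < d →
    ∀ a ∈ Ideal.span (Set.range x),
      ∀ v : ((localCohomology (maximalIdeal R) i).obj
        (ModuleCat.of R (R ⧸ Ideal.span (x '' {k : Fin d | (k : ℕ) < j})))), a • v = 0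

/-- `R` is a regular local ring of dimension `d`: `𝔪` is generated by `d` elements. -/
def IsRegularLocal (d : ℕ) : Prop :=
  ∃ x : Fin d → R, maximalIdeal R = Ideal.span (Set.range x)

/-- `R` is Gorenstein: `R` is Cohen–Macaulay of Cohen–Macaulay type `r(R) = 1`. -/
def IsGorenstein (d : ℕ) : Prop :=
  IsCohenMacaulay R ∧ cmType R d = 1

section Preliminaries

open Limits

namespace CategoryTheory.ProjectiveResolution
universe v u v' u'
variable {C : Type u} [Category.{v} C] [Abelian C] {E : Type u'} [Category.{v'} E] [Abelian E]

lemma exists_lift_shortExact {S : ShortComplex C} (hS : S.ShortExact)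
    (P : ProjectiveResolution S.X₃) :
    ∃ (ρ : P.complex.X 0 ⟶ S.X₂) (κ : P.complex.X 1 ⟶ S.X₁),
      ρ ≫ S.g = P.π.f 0 ∧ κ ≫ S.f = P.complex.d 1 0 ≫ ρ := by
  have := hS.mono_f
  have := hS.epi_g
  have : Projective (P.complex.X 0) := P.projective 0
  let π₀ : P.complex.X 0 ⟶ S.X₃ := P.π.f 0
  have hπ : P.complex.d 1 0 ≫ π₀ = 0 := P.complex_d_comp_π_f_zero
  have h : (P.complex.d 1 0 ≫ Projective.factorThru π₀ S.g) ≫ S.g = 0 := by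
    rw [Category.assoc, Projective.factorThru_comp, hπ]
  exact ⟨Projective.factorThru π₀ S.g, hS.exact.lift _ h,
    Projective.factorThru_comp _ _, hS.exact.lift_f _ _⟩

/-- The comparison of the resolution of the cokernel with the kernel, in degree one. -/
noncomputable def liftKernel {S : ShortComplex C} (hS : S.ShortExact)
    (P : ProjectiveResolution S.X₃) : P.complex.X 1 ⟶ S.X₁ :=
  (P.exists_lift_shortExact hS).choose_spec.choose

lemma liftKernel_spec {S : ShortComplex C} (hS : S.ShortExact) (P : ProjectiveResolution S.X₃) :
    ∃ ρ : P.complex.X 0 ⟶ S.X₂, ρ ≫ S.g = P.π.f 0 ∧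
      P.liftKernel hS ≫ S.f = P.complex.d 1 0 ≫ ρ :=
  ⟨_, (P.exists_lift_shortExact hS).choose_spec.choose_spec⟩

lemma d_liftKernel {S : ShortComplex C} (hS : S.ShortExact) (P : ProjectiveResolution S.X₃) :
    P.complex.d 2 1 ≫ P.liftKernel hS = 0 := by
  have := hS.mono_f
  obtain ⟨ρ, -, h⟩ := P.liftKernel_spec hS
  rw [← cancel_mono S.f, Category.assoc, h, P.complex.d_comp_d_assoc, zero_comp, zero_comp]

variable (F : C ⥤ E) [F.Additive]

/-- The map from opcycles inducing the connecting map. -/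
noncomputable def descLiftKernel {S : ShortComplex C} (hS : S.ShortExact)
    (P : ProjectiveResolution S.X₃) :
    ((F.mapHomologicalComplex _).obj P.complex).opcycles 1 ⟶ F.obj S.X₁ :=
  HomologicalComplex.descOpcycles _ (F.map (P.liftKernel hS)) 2 (by simp)
    ((F.map_comp _ _).symm.trans ((congrArg F.map (P.d_liftKernel hS)).trans (F.map_zero _ _)))

lemma pOpcycles_descLiftKernel {S : ShortComplex C} (hS : S.ShortExact)
    (P : ProjectiveResolution S.X₃) :
    HomologicalComplex.pOpcycles _ 1 ≫ P.descLiftKernel F hS = F.map (P.liftKernel hS) :=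
  HomologicalComplex.p_descOpcycles _ _ _ _ _

variable [HasProjectiveResolutions C]

/-- The first left derived functor embeds in the opcycles of any resolution. -/
noncomputable def toOpcycles {X : C} (P : ProjectiveResolution X) :
    (F.leftDerived 1).obj X ⟶ ((F.mapHomologicalComplex _).obj P.complex).opcycles 1 :=
  (P.isoLeftDerivedObj F 1).hom ≫
    (((F.mapHomologicalComplex _).obj P.complex).homologyι 1 :)

lemma toOpcycles_descOpcycles {X : C} (P : ProjectiveResolution X) {A : E}
    (k : ((F.mapHomologicalComplex (ComplexShape.down ℕ)).obj P.complex).X 1 ⟶ A)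
    (x : ((F.mapHomologicalComplex (ComplexShape.down ℕ)).obj P.complex).X 0 ⟶ A)
    (hx : k = ((F.mapHomologicalComplex (ComplexShape.down ℕ)).obj P.complex).d 1 0 ≫ x)
    (j : ((F.mapHomologicalComplex (ComplexShape.down ℕ)).obj P.complex).opcycles 1 ⟶ A)
    (hj : HomologicalComplex.pOpcycles _ 1 ≫ j = k) :
    P.toOpcycles F ≫ j = 0 := by
  have e := HomologicalComplex.homologyι_descOpcycles_eq_zero_of_boundary
    ((F.mapHomologicalComplex (ComplexShape.down ℕ)).obj P.complex) k 2 (by simp) (i' := 0) x hx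
  have hj' : j = HomologicalComplex.descOpcycles _ k 2 (by simp)
      (by rw [hx, HomologicalComplex.d_comp_d_assoc, zero_comp]) := by
    rw [← cancel_epi (HomologicalComplex.pOpcycles _ _), hj, HomologicalComplex.p_descOpcycles]
  rw [toOpcycles, hj']
  exact (Category.assoc _ _ _).trans ((congrArg _ e).trans comp_zero)

lemma toOpcycles_naturality {X Y : C} (f : X ⟶ Y) (P : ProjectiveResolution X)
    (Q : ProjectiveResolution Y) (φ : P.complex ⟶ Q.complex)
    (comm : φ.f 0 ≫ Q.π.f 0 = P.π.f 0 ≫ f) :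
    (F.leftDerived 1).map f ≫ Q.toOpcycles F =
      P.toOpcycles F ≫ HomologicalComplex.opcyclesMap ((F.mapHomologicalComplex _).map φ) 1 := by
  have e1 := isoLeftDerivedObj_hom_naturality_assoc f P Q φ comm F 1
    (HomologicalComplex.homologyι ((F.mapHomologicalComplex _).obj Q.complex) 1)
  have e2 := HomologicalComplex.homologyι_naturality ((F.mapHomologicalComplex _).map φ) 1
  exact e1.trans ((congrArg _ e2).trans (Category.assoc _ _ _).symm)

lemma toOpcycles_fromOpcycles {X : C} (P : ProjectiveResolution X) :
    P.toOpcycles F ≫ HomologicalComplex.fromOpcycles _ 1 0 = 0 :=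
  P.toOpcycles_descOpcycles F _ (𝟙 _) (Category.comp_id _).symm _
    (HomologicalComplex.p_fromOpcycles _ _ _)

lemma exact_toOpcycles {X : C} (P : ProjectiveResolution X) :
    (ShortComplex.mk _ _ (P.toOpcycles_fromOpcycles F)).Exact := by
  refine ShortComplex.exact_of_iso (S₁ := ShortComplex.mk
    (((F.mapHomologicalComplex _).obj P.complex).homologyι 1) _
      (HomologicalComplex.homologyι_comp_fromOpcycles _ 1 0))
    (ShortComplex.isoMk (P.isoLeftDerivedObj F 1).symm (Iso.refl _) (Iso.refl _) ?_ ?_) ?_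
  · exact ((P.isoLeftDerivedObj F 1).inv_hom_id_assoc _).trans (Category.comp_id _).symm
  · exact (Category.id_comp _).trans (Category.comp_id _).symm
  · exact ShortComplex.exact_of_f_is_kernel _ (HomologicalComplex.homologyIsKernel _ 1 0 (by simp))

/-- The connecting map of a short exact sequence, computed with a projective resolution. -/
noncomputable def connecting {S : ShortComplex C} (hS : S.ShortExact)
    (P : ProjectiveResolution S.X₃) : (F.leftDerived 1).obj S.X₃ ⟶ F.obj S.X₁ :=
  P.toOpcycles F ≫ P.descLiftKernel F hS

lemma connecting_comp {S : ShortComplex C} (hS : S.ShortExact) (P : ProjectiveResolution S.X₃) :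
    P.connecting F hS ≫ F.map S.f = 0 := by
  obtain ⟨ρ, -, h⟩ := P.liftKernel_spec hS
  rw [connecting, Category.assoc]
  refine P.toOpcycles_descOpcycles F _ (F.map ρ) rfl _ ?_
  rw [← Category.assoc, pOpcycles_descLiftKernel]
  exact (F.map_comp _ _).symm.trans ((congrArg F.map h).trans (F.map_comp _ _))

lemma connecting_naturality {S T : ShortComplex C} (hS : S.ShortExact) (hT : T.ShortExact)
    (P : ProjectiveResolution S.X₃) (Q : ProjectiveResolution T.X₃) (f : S ⟶ T) :
    (F.leftDerived 1).map f.τ₃ ≫ Q.connecting F hT = P.connecting F hS ≫ F.map f.τ₁ := by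
  have := hT.mono_f
  obtain ⟨ρ, hρ, h⟩ := P.liftKernel_spec hS
  obtain ⟨ρ', hρ', h'⟩ := Q.liftKernel_spec hT
  let φ := lift f.τ₃ P Q
  have hφ : φ.f 0 ≫ Q.π.f 0 = P.π.f 0 ≫ f.τ₃ := lift_commutes_zero f.τ₃ P Q
  have hρ₁ : φ.f 0 ≫ ρ' ≫ T.g = ρ ≫ S.g ≫ f.τ₃ := by
    rw [hρ', reassoc_of% hρ]
    exact hφ
  obtain ⟨s, hs⟩ : ∃ s : P.complex.X 0 ⟶ T.X₁, s ≫ T.f = φ.f 0 ≫ ρ' - ρ ≫ f.τ₂ := by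
    have h0 : (φ.f 0 ≫ ρ' - ρ ≫ f.τ₂) ≫ T.g = 0 := by
      rw [Preadditive.sub_comp, Category.assoc, Category.assoc, f.comm₂₃, hρ₁, sub_self]
    exact ⟨hT.exact.lift _ h0, hT.exact.lift_f _ _⟩
  have key : φ.f 1 ≫ Q.liftKernel hT = P.liftKernel hS ≫ f.τ₁ + P.complex.d 1 0 ≫ s := by
    rw [← cancel_mono T.f]
    simp only [Category.assoc, Preadditive.add_comp, h', hs, f.comm₁₂, reassoc_of% h,
      Preadditive.comp_sub]
    rw [φ.comm_assoc]
    abel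
  rw [connecting, connecting, ← Category.assoc, toOpcycles_naturality F f.τ₃ P Q φ hφ,
    Category.assoc, Category.assoc, ← sub_eq_zero, ← Preadditive.comp_sub]
  refine P.toOpcycles_descOpcycles F _ (F.map s) rfl _ ?_
  rw [Preadditive.comp_sub, HomologicalComplex.p_opcyclesMap_assoc, pOpcycles_descLiftKernel,
    ← Category.assoc, pOpcycles_descLiftKernel, sub_eq_iff_eq_add']
  exact (F.map_comp _ _).symm.trans ((congrArg F.map key).trans
    ((F.map_add).trans (congrArg₂ _ (F.map_comp _ _) (F.map_comp _ _))))

end CategoryTheory.ProjectiveResolution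

section ExtConnecting
universe u
variable {R : Type u} [CommRing R]

lemma ModuleCat.unop_hom_congr {A B : (ModuleCat.{u} R)ᵒᵖ} {f g : A ⟶ B} (h : f = g) (y : B.unop) :
    f.unop.hom y = g.unop.hom y := by rw [h]

/-- The functor `Hom(-, Y)` whose left derived functors are `Ext(-, Y)`. -/
noncomputable abbrev ModuleCat.homFunctor (Y : ModuleCat.{u} R) :
    ModuleCat.{u} R ⥤ (ModuleCat.{u} R)ᵒᵖ :=
  ((linearYoneda R (ModuleCat.{u} R)).obj Y).rightOp

/-- The connecting map `Hom(S.X₁, Y) → Ext¹(S.X₃, Y)`. -/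
noncomputable def extConnecting {S : ShortComplex (ModuleCat.{u} R)} (hS : S.ShortExact)
    (Y : ModuleCat.{u} R) :
    (S.X₁ ⟶ Y) →ₗ[R] ((Ext R (ModuleCat.{u} R) 1).obj (Opposite.op S.X₃)).obj Y :=
  ((projectiveResolution S.X₃).connecting (ModuleCat.homFunctor Y) hS).unop.hom

lemma extConnecting_comp {S : ShortComplex (ModuleCat.{u} R)} (hS : S.ShortExact)
    {Y : ModuleCat.{u} R} (g : S.X₂ ⟶ Y) : extConnecting hS Y (S.f ≫ g) = 0 := by
  have h := (projectiveResolution S.X₃).connecting_comp (ModuleCat.homFunctor Y) hS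
  exact ModuleCat.unop_hom_congr h g

lemma extConnecting_naturality {S T : ShortComplex (ModuleCat.{u} R)} (hS : S.ShortExact)
    (hT : T.ShortExact) (f : S ⟶ T) {Y : ModuleCat.{u} R} (g : T.X₁ ⟶ Y) :
    (((Ext R (ModuleCat.{u} R) 1).map f.τ₃.op).app Y).hom (extConnecting hT Y g) =
      extConnecting hS Y (f.τ₁ ≫ g) := by
  have h := (projectiveResolution S.X₃).connecting_naturality (ModuleCat.homFunctor Y) hS hT
    (projectiveResolution T.X₃) f
  exact ModuleCat.unop_hom_congr h g

lemma exists_comp_eq_of_extConnecting_eq_zero {S : ShortComplex (ModuleCat.{u} R)}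
    (hS : S.ShortExact) [Projective S.X₂] {Y : ModuleCat.{u} R} (φ : S.X₁ ⟶ Y)
    (h0 : extConnecting hS Y φ = 0) : ∃ g : S.X₂ ⟶ Y, S.f ≫ g = φ := by
  let P := projectiveResolution S.X₃
  let F := ModuleCat.homFunctor Y
  have := hS.mono_f
  have := hS.epi_g
  obtain ⟨ρ, hρ, h⟩ := P.liftKernel_spec hS
  let π : P.complex.X 0 ⟶ S.X₃ := P.π.f 0
  have : Epi π := inferInstanceAs (Epi (P.π.f 0))
  obtain ⟨ψ, hψ⟩ : ∃ ψ : P.complex.X 0 ⟶ Y,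
      P.liftKernel hS ≫ φ = P.complex.d 1 0 ≫ ψ := by
    obtain ⟨ψ, hψ⟩ := (ShortComplex.moduleCat_exact_iff _).1 (P.exact_toOpcycles F).unop
      ((P.descLiftKernel F hS).unop.hom φ) h0
    refine ⟨ψ, ?_⟩
    have e1 := ModuleCat.unop_hom_congr (P.pOpcycles_descLiftKernel F hS) φ
    have e2 := ModuleCat.unop_hom_congr
      (HomologicalComplex.p_fromOpcycles ((F.mapHomologicalComplex _).obj P.complex) 1 0) ψ
    exact e1.symm.trans ((congrArg (HomologicalComplex.pOpcycles
      ((F.mapHomologicalComplex (ComplexShape.down ℕ)).obj P.complex) 1).unop.hom hψ.symm).trans e2)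
  let σ : S.X₂ ⟶ P.complex.X 0 := Projective.factorThru S.g π
  have hσ : σ ≫ π = S.g := Projective.factorThru_comp _ _
  have hu : (σ ≫ ρ - 𝟙 _) ≫ S.g = 0 := by
    rw [Preadditive.sub_comp, Category.assoc, hρ, Category.id_comp, sub_eq_zero]
    exact hσ
  let u := hS.exact.lift _ hu
  have hu' : u ≫ S.f = σ ≫ ρ - 𝟙 _ := hS.exact.lift_f _ _
  refine ⟨σ ≫ ψ - u ≫ φ, ?_⟩
  ext k
  have hk : π.hom (σ.hom (S.f.hom k)) = 0 := by
    have := congrArg (fun t => t.hom k) S.zero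
    rw [← hσ] at this
    exact this
  obtain ⟨w, hw⟩ := (ShortComplex.moduleCat_exact_iff _).1 P.exact₀ (σ.hom (S.f.hom k)) hk
  replace hw : (P.complex.d 1 0).hom w = σ.hom (S.f.hom k) := hw
  have hinj := (ModuleCat.mono_iff_injective S.f).1 inferInstance
  have e1 : (P.liftKernel hS).hom w = k + u.hom (S.f.hom k) := by
    apply hinj
    have a1 := congrArg (fun t => t.hom w) h
    have a2 := congrArg (fun t => t.hom (S.f.hom k)) hu'
    simp only [ModuleCat.hom_comp, LinearMap.comp_apply, ModuleCat.hom_sub, LinearMap.sub_apply,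
      ModuleCat.hom_id, LinearMap.id_apply, hw] at a1 a2
    exact a1.trans (by rw [map_add]; exact ((congrArg (_ + ·) a2).trans (by abel)).symm)
  have a3 := congrArg (fun t => t.hom w) hψ
  simp only [ModuleCat.hom_comp, LinearMap.comp_apply, hw, e1, map_add] at a3
  simp only [ModuleCat.hom_comp, LinearMap.comp_apply, ModuleCat.hom_sub, LinearMap.sub_apply,
    ← a3]
  abel

/-- The comparison `Hom(X, Y) → Ext⁰(X, Y)`. -/
noncomputable def homToExt (X Y : ModuleCat.{u} R) :
    (X ⟶ Y) →ₗ[R] ((Ext R (ModuleCat.{u} R) 0).obj (Opposite.op X)).obj Y :=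
  ((ModuleCat.homFunctor Y).fromLeftDerivedZero.app X).unop.hom

lemma homToExt_naturality {X X' Y : ModuleCat.{u} R} (f : X ⟶ X') (g : X' ⟶ Y) :
    (((Ext R (ModuleCat.{u} R) 0).map f.op).app Y).hom (homToExt X' Y g) =
      homToExt X Y (f ≫ g) := by
  have h := (ModuleCat.homFunctor Y).fromLeftDerivedZero.naturality f
  exact ModuleCat.unop_hom_congr h g

lemma homToExt_injective (X Y : ModuleCat.{u} R) : Function.Injective (homToExt X Y) := by
  have h1 : PreservesLimits ((linearYoneda R (ModuleCat.{u} R)).obj Y ⋙ forget (ModuleCat.{u} R)) :=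
    inferInstanceAs (PreservesLimits (yoneda.obj Y))
  have h2 : PreservesLimits ((linearYoneda R (ModuleCat.{u} R)).obj Y) :=
    preservesLimits_of_reflects_of_preserves _ (forget (ModuleCat.{u} R))
  have h3 : PreservesFiniteColimits (ModuleCat.homFunctor Y) :=
    preservesFiniteColimits_rightOp _
  have h4 : IsIso ((ModuleCat.homFunctor Y).fromLeftDerivedZero.app X) := inferInstance
  exact (ModuleCat.mono_iff_injective _).1
    (inferInstanceAs (Mono ((ModuleCat.homFunctor Y).fromLeftDerivedZero.app X).unop))

end ExtConnecting

section LocalCohomology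
variable {R : Type} [CommRing R]

/-- The short complex `I → R → R ⧸ I`. -/
def idealShortComplex (I : Ideal R) : ShortComplex (ModuleCat R) :=
  ShortComplex.mk (ModuleCat.ofHom I.subtype) (ModuleCat.ofHom (Submodule.mkQ I)) (by
    ext a
    exact (Submodule.Quotient.mk_eq_zero I).2 a.2)

lemma idealShortComplex_shortExact (I : Ideal R) : (idealShortComplex I).ShortExact where
  exact := (ShortComplex.moduleCat_exact_iff _).2 fun a ha =>
    ⟨⟨a, (Submodule.Quotient.mk_eq_zero I).1 ha⟩, rfl⟩
  mono_f := (ModuleCat.mono_iff_injective _).2 I.subtype_injective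
  epi_g := (ModuleCat.epi_iff_surjective _).2 (Submodule.mkQ_surjective I)

/-- The morphism of short complexes induced by an inclusion of ideals. -/
def idealShortComplexMap {I J : Ideal R} (h : I ≤ J) :
    idealShortComplex I ⟶ idealShortComplex J where
  τ₁ := ModuleCat.ofHom (Submodule.inclusion h)
  τ₂ := 𝟙 _
  τ₃ := ModuleCat.ofHom (Submodule.mapQ I J LinearMap.id h)
  comm₁₂ := rfl
  comm₂₃ := rfl

/-- The map from `Ext` to the local cohomology, seen as a colimit. -/
noncomputable def extToLocalCohomology (J : Ideal R) (i t : ℕ) (M : ModuleCat R) :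
    ((Ext R (ModuleCat R) i).obj
      (Opposite.op (ModuleCat.of R (R ⧸ J ^ t)))).obj M →ₗ[R] (localCohomology J i).obj M :=
  ((colimit.ι (localCohomology.diagram (localCohomology.idealPowersDiagram J) i)
    (Opposite.op (Opposite.op t))).app M).hom

lemma exists_map_eq_zero_of_extToLocalCohomology_eq_zero (J : Ideal R) (i t : ℕ)
    (M : ModuleCat R) (e : ((Ext R (ModuleCat R) i).obj
      (Opposite.op (ModuleCat.of R (R ⧸ J ^ t)))).obj M)
    (he : extToLocalCohomology J i t M e = 0) :
    ∃ (t' : ℕ) (h : J ^ t' ≤ J ^ t), (((Ext R (ModuleCat R) i).map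
      (ModuleCat.ofHom (Submodule.mapQ _ _ LinearMap.id h)).op).app M).hom e = 0 := by
  let D := localCohomology.diagram (localCohomology.idealPowersDiagram J) i
  have hc := isColimitOfPreserves ((evaluation _ _).obj M) (colimit.isColimit D)
  obtain ⟨k, f, g, hfg⟩ := Concrete.isColimit_exists_of_rep_eq
    (D ⋙ (evaluation (ModuleCat R) (ModuleCat R)).obj M) hc
    (i := Opposite.op (Opposite.op t)) (j := Opposite.op (Opposite.op t)) e 0
    (he.trans (map_zero _).symm)
  refine ⟨k.unop.unop, Ideal.pow_le_pow_right f.unop.unop.down.down, hfg.trans ?_⟩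
  exact map_zero (((D.map g).app M).hom)

lemma exists_localCohomology_zero (J : Ideal R) (t : ℕ) (M : Type) [AddCommGroup M]
    [Module R M] :
    ∃ g : ((R ⧸ J ^ t) →ₗ[R] M) →ₗ[R] (localCohomology J 0).obj (ModuleCat.of R M),
      Function.Injective g := by
  refine ⟨extToLocalCohomology J 0 t _ ∘ₗ homToExt _ _ ∘ₗ
    (ModuleCat.homLinearEquiv (S := R) (M := ModuleCat.of R (R ⧸ J ^ t))
      (N := ModuleCat.of R M)).symm.toLinearMap, ?_⟩
  rw [injective_iff_map_eq_zero]
  intro φ hφ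
  obtain ⟨t', h, h0⟩ := exists_map_eq_zero_of_extToLocalCohomology_eq_zero J 0 t _ _ hφ
  have h1 := (homToExt_naturality _ _).symm.trans h0
  have h2 := homToExt_injective _ _ (h1.trans (map_zero _).symm)
  ext
  exact LinearMap.congr_fun (congrArg ModuleCat.Hom.hom h2) (Submodule.Quotient.mk 1)

lemma exists_localCohomology_one (J : Ideal R) (t : ℕ) (M : Type) [AddCommGroup M]
    [Module R M] :
    ∃ g : (↥(J ^ t) →ₗ[R] M) →ₗ[R] (localCohomology J 1).obj (ModuleCat.of R M),
      (∀ ψ : R →ₗ[R] M, g (ψ ∘ₗ (J ^ t).subtype) = 0) ∧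
      ∀ φ, g φ = 0 → ∃ (t' : ℕ) (h : J ^ t' ≤ J ^ t) (ψ : R →ₗ[R] M),
        φ ∘ₗ Submodule.inclusion h = ψ ∘ₗ (J ^ t').subtype := by
  refine ⟨extToLocalCohomology J 1 t _ ∘ₗ
    extConnecting (idealShortComplex_shortExact (J ^ t)) _ ∘ₗ
    (ModuleCat.homLinearEquiv (S := R) (M := ModuleCat.of R ↥(J ^ t))
      (N := ModuleCat.of R M)).symm.toLinearMap, fun ψ => ?_, fun φ hφ => ?_⟩
  · exact (congrArg (extToLocalCohomology J 1 t (ModuleCat.of R M)) (extConnecting_comp (idealShortComplex_shortExact (J ^ t))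
      (ModuleCat.ofHom ψ))).trans
      (map_zero (extToLocalCohomology J 1 t (ModuleCat.of R M)))
  · obtain ⟨t', h, h0⟩ := exists_map_eq_zero_of_extToLocalCohomology_eq_zero J 1 t _ _ hφ
    have h1 := (extConnecting_naturality (idealShortComplex_shortExact (J ^ t')) _
      (idealShortComplexMap h) _).symm.trans h0
    have : Projective (idealShortComplex (J ^ t')).X₂ :=
      inferInstanceAs (Projective (ModuleCat.of R R))
    obtain ⟨ψ, hψ⟩ := exists_comp_eq_of_extConnecting_eq_zero _ _ h1
    exact ⟨t', h, ψ.hom, (congrArg ModuleCat.Hom.hom hψ).symm⟩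

end LocalCohomology

section Lengths
variable {R : Type*} [CommRing R]

lemma Submodule.length_mono {M : Type*} [AddCommGroup M] [Module R M] {P Q : Submodule R M}
    (h : P ≤ Q) : Module.length R P ≤ Module.length R Q :=
  Module.length_le_of_injective (Submodule.inclusion h) (Submodule.inclusion_injective h)

lemma LinearMap.length_range_le_of_ker_le {M N P : Type*} [AddCommGroup M] [Module R M]
    [AddCommGroup N] [Module R N] [AddCommGroup P] [Module R P] (f : M →ₗ[R] N) (g : M →ₗ[R] P)
    (h : ker g ≤ ker f) : Module.length R (range f) ≤ Module.length R (range g) := by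
  rw [← f.quotKerEquivRange.length_eq, ← g.quotKerEquivRange.length_eq]
  exact Module.length_le_of_surjective (Submodule.factor h) (Submodule.factor_surjective h)

/-- The annihilator of an element, as an ideal. -/
abbrev Ideal.ann (x : R) : Ideal R := LinearMap.ker (LinearMap.mulLeft R x)

lemma Ideal.mem_ann {x a : R} : a ∈ Ideal.ann x ↔ x * a = 0 := by simp

/-- Filtering `R ⧸ yK` by `yR`, with `yR ⧸ yK ≃ R ⧸ (K + ann y)`. -/
lemma Ideal.length_quotient_span_singleton_mul (y : R) (K : Ideal R) :
    Module.length R (R ⧸ Ideal.span {y} * K) =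
      Module.length R (R ⧸ K ⊔ Ideal.ann y) + Module.length R (R ⧸ Ideal.span {y}) := by
  have hle : K ⊔ Ideal.ann y ≤
      Submodule.comap (LinearMap.mulLeft R y) (Ideal.span {y} * K) := by
    refine sup_le (fun k hk => ?_) fun a ha => ?_
    · exact Ideal.mul_mem_mul (Ideal.mem_span_singleton_self y) hk
    · simp only [Submodule.mem_comap]
      rw [LinearMap.mem_ker.1 ha]
      exact zero_mem _
  refine Module.length_eq_add_of_exact (Submodule.mapQ _ _ (LinearMap.mulLeft R y) hle)
    (Submodule.factor Ideal.mul_le_left) ?_ (Submodule.factor_surjective _) ?_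
  · rw [← LinearMap.ker_eq_bot, Submodule.ker_mapQ]
    refine LinearMap.le_ker_iff_map.1 fun a ha => ?_
    rw [Submodule.ker_mkQ]
    obtain ⟨k, hk, h⟩ := Ideal.mem_span_singleton_mul.1 ha
    have : a = k + (a - k) := by ring
    rw [this]
    refine add_mem (Ideal.mem_sup_left hk) (Ideal.mem_sup_right (Ideal.mem_ann.2 ?_))
    rw [mul_sub, h]
    simp
  · intro a
    obtain ⟨a, rfl⟩ := Submodule.Quotient.mk_surjective _ a
    constructor
    · intro h
      obtain ⟨b, rfl⟩ := Ideal.mem_span_singleton'.1 ((Submodule.Quotient.mk_eq_zero _).1 h)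
      exact ⟨Submodule.Quotient.mk b, congrArg _ (mul_comm _ _)⟩
    · rintro ⟨b, hb⟩
      obtain ⟨b, rfl⟩ := Submodule.Quotient.mk_surjective _ b
      rw [← hb]
      exact (Submodule.Quotient.mk_eq_zero _).2
        (Ideal.mem_span_singleton'.2 ⟨b, mul_comm _ _⟩)

lemma Submodule.length_quotient_eq_add {M : Type*} [AddCommGroup M] [Module R M]
    (P Q : Submodule R M) :
    Module.length R (M ⧸ P) = Module.length R (Q.map P.mkQ) + Module.length R (M ⧸ Q ⊔ P) := by
  refine Module.length_eq_add_of_exact (Q.map P.mkQ).subtype (Submodule.factor le_sup_right)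
    (Submodule.subtype_injective _) (Submodule.factor_surjective _) ?_
  intro a
  obtain ⟨a, rfl⟩ := Submodule.Quotient.mk_surjective _ a
  constructor
  · intro h
    obtain ⟨b, hb, c, hc, rfl⟩ := Submodule.mem_sup.1 ((Submodule.Quotient.mk_eq_zero _).1 h)
    refine ⟨⟨P.mkQ b, Submodule.mem_map_of_mem hb⟩, ?_⟩
    exact ((Submodule.Quotient.eq P).2 (by simpa using hc)).symm
  · rintro ⟨⟨_, b, hb, rfl⟩, h⟩
    rw [← h]
    exact (Submodule.Quotient.mk_eq_zero _).2 (Submodule.mem_sup_left hb)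

end Lengths

section ColonPowers
variable {R : Type} [CommRing R]

/-- The image of `yR : J` in `R ⧸ (yR + ann x)`. -/
abbrev colonImage (J : Ideal R) (x y : R) : Submodule R (R ⧸ Ideal.span {y} ⊔ Ideal.ann x) :=
  Submodule.map (Submodule.mkQ _) ((Ideal.span {y}).colon (J : Set R))

lemma length_colon_quotient {J : Ideal R} {x y : R} (hx : x ∈ J)
    (hd : Disjoint (Ideal.span {y}) (Ideal.ann x)) :
    Module.length R (↥((Ideal.span {y}).colon (J : Set R)) ⧸
      Submodule.comap ((Ideal.span {y}).colon (J : Set R)).subtype (Ideal.span {y})) =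
    Module.length R ↥((⊥ : Ideal R).colon (J : Set R)) + Module.length R (colonImage J x y) := by
  have hS : (⊥ : Ideal R).colon (J : Set R) ≤ (Ideal.span {y}).colon (J : Set R) :=
    Submodule.colon_mono bot_le subset_rfl
  have hSW : (⊥ : Ideal R).colon (J : Set R) ≤ Ideal.ann x := fun a ha =>
    Ideal.mem_ann.2 ((mul_comm _ _).trans (Submodule.mem_colon.1 ha x hx))
  have hann : ∀ a, (∀ j ∈ J, a * j ∈ Ideal.span {y}) → a ∈ Ideal.ann x →
      a ∈ (⊥ : Ideal R).colon (J : Set R) := fun a ha haW =>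
    Submodule.mem_colon.2 fun j hj =>
      (Submodule.mem_bot R).2 (Submodule.disjoint_def.1 hd _ (ha j hj) (Ideal.mul_mem_right _ _ haW))
  let p : ↥((Ideal.span {y}).colon (J : Set R)) →ₗ[R] colonImage J x y :=
    (Submodule.mkQ _).submoduleMap _
  have hp : Submodule.comap ((Ideal.span {y}).colon (J : Set R)).subtype (Ideal.span {y}) ≤
      LinearMap.ker p := fun a ha => by
    refine LinearMap.mem_ker.2 (Subtype.ext ?_)
    exact (Submodule.Quotient.mk_eq_zero _).2 (Ideal.mem_sup_left ha)
  refine Module.length_eq_add_of_exact (Submodule.mkQ _ ∘ₗ Submodule.inclusion hS)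
    (Submodule.liftQ _ p hp) ?_ ?_ ?_
  · rw [injective_iff_map_eq_zero]
    intro a ha
    have : Submodule.inclusion hS a ∈ Submodule.comap _ (Ideal.span {y}) :=
      (Submodule.Quotient.mk_eq_zero _).1 ha
    exact Subtype.ext (Submodule.disjoint_def.1 hd _ this (hSW a.2))
  · intro b
    obtain ⟨a, ha⟩ := LinearMap.submoduleMap_surjective _ _ b
    exact ⟨Submodule.Quotient.mk a, ha⟩
  · intro a
    obtain ⟨a, rfl⟩ := Submodule.Quotient.mk_surjective _ a
    constructor
    · intro h
      have h' : (a : R) ∈ Ideal.span {y} ⊔ Ideal.ann x :=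
        (Submodule.Quotient.mk_eq_zero _).1 (congrArg Subtype.val h)
      obtain ⟨b, hb, c, hc, hbc⟩ := Submodule.mem_sup.1 h'
      have hc' : c ∈ (⊥ : Ideal R).colon (J : Set R) := hann c (fun j hj => by
        have : c * j = a * j - b * j := by rw [← hbc]; ring
        rw [this]
        exact sub_mem (Submodule.mem_colon.1 a.2 j hj) (Ideal.mul_mem_right _ _ hb)) hc
      refine ⟨⟨c, hc'⟩, (Submodule.Quotient.eq _).2 ?_⟩
      have : c - a = -b := by rw [← hbc]; ring
      have h2 : c - a ∈ Ideal.span {y} := this ▸ neg_mem hb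
      exact h2
    · rintro ⟨b, hb⟩
      rw [← hb]
      exact Subtype.ext ((Submodule.Quotient.mk_eq_zero _).2 (Ideal.mem_sup_right (hSW b.2)))

variable {J : Ideal R} {x : R}

lemma disjoint_span_pow_ann (h : ∀ n a, x ^ n * a = 0 → x * a = 0) {n : ℕ} (hn : 1 ≤ n) :
    Disjoint (Ideal.span {x ^ n}) (Ideal.ann x) := by
  rw [Submodule.disjoint_def]
  intro a ha haW
  obtain ⟨b, rfl⟩ := Ideal.mem_span_singleton'.1 ha
  obtain ⟨n, rfl⟩ := Nat.exists_eq_add_of_le' hn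
  have := h (n + 2) b (by rw [← Ideal.mem_ann.1 haW]; ring)
  rw [pow_succ, mul_left_comm, mul_comm b, this, mul_zero]

lemma ann_pow_eq (h : ∀ n a, x ^ n * a = 0 → x * a = 0) {n : ℕ} (hn : 1 ≤ n) :
    Ideal.ann (x ^ n) = Ideal.ann x := by
  ext a
  rw [Ideal.mem_ann, Ideal.mem_ann]
  refine ⟨h n a, fun ha => ?_⟩
  obtain ⟨n, rfl⟩ := Nat.exists_eq_add_of_le' hn
  rw [pow_succ, mul_assoc, ha, mul_zero]

lemma length_colonImage_le (h : ∀ n a, x ^ n * a = 0 → x * a = 0) (n : ℕ) :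
    Module.length R (colonImage J x x) ≤ Module.length R (colonImage J x (x ^ (n + 1))) := by
  have hle : Ideal.span {x} ⊔ Ideal.ann x ≤ Submodule.comap (LinearMap.mulLeft R (x ^ n))
      (Ideal.span {x ^ (n + 1)} ⊔ Ideal.ann x) := by
    refine sup_le (fun a ha => ?_) fun a ha => ?_
    · obtain ⟨b, rfl⟩ := Ideal.mem_span_singleton'.1 ha
      exact Ideal.mem_sup_left (Ideal.mem_span_singleton'.2 ⟨b, by simp; ring⟩)
    · exact Ideal.mem_sup_right (Ideal.mul_mem_left _ _ ha)
  have hinj : Function.Injective (Submodule.mapQ _ _ (LinearMap.mulLeft R (x ^ n)) hle) := by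
    rw [← LinearMap.ker_eq_bot, Submodule.ker_mapQ]
    refine LinearMap.le_ker_iff_map.1 fun a ha => ?_
    rw [Submodule.ker_mkQ]
    obtain ⟨b, hb, w, hw, hbw⟩ := Submodule.mem_sup.1 ha
    obtain ⟨b, rfl⟩ := Ideal.mem_span_singleton'.1 hb
    have hbw : b * x ^ (n + 1) + w = x ^ n * a := hbw
    have hW := h (n + 1) (a - x * b) (by
      have := Ideal.mem_ann.1 hw
      rw [show w = x ^ n * a - b * x ^ (n + 1) by rw [← hbw]; ring] at this
      rw [← this]
      ring)
    rw [show a = b * x + (a - x * b) by ring]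
    exact add_mem (Ideal.mem_sup_left (Ideal.mem_span_singleton'.2 ⟨b, rfl⟩))
      (Ideal.mem_sup_right (Ideal.mem_ann.2 hW))
  rw [(Submodule.equivMapOfInjective _ hinj (colonImage J x x)).length_eq]
  refine Submodule.length_mono ?_
  rintro _ ⟨_, ⟨a, ha, rfl⟩, rfl⟩
  refine Submodule.mem_map.2 ⟨x ^ n * a, Submodule.mem_colon.2 fun j hj => ?_, rfl⟩
  obtain ⟨b, hb⟩ := Ideal.mem_span_singleton'.1 (Submodule.mem_colon.1 ha j hj)
  refine Ideal.mem_span_singleton'.2 ⟨b, ?_⟩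
  simp only [smul_eq_mul] at hb ⊢
  rw [mul_assoc, ← hb]
  ring

lemma length_socle_le (J : Ideal R) :
    Module.length R ↥((⊥ : Ideal R).colon (J : Set R)) ≤
      Module.length R ↥(Submodule.torsionBySet R
        ↥((localCohomology J 0).obj (ModuleCat.of R R)) (J : Set R)) := by
  obtain ⟨g, hg⟩ := exists_localCohomology_zero J 1 R
  have hJ : ∀ a : ↥((⊥ : Ideal R).colon (J : Set R)), ∀ j ∈ J, j * (a : R) = 0 := fun a j hj =>
    (mul_comm _ _).trans (Submodule.mem_colon.1 a.2 j hj)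
  let φ : ↥((⊥ : Ideal R).colon (J : Set R)) →ₗ[R] ((R ⧸ J ^ 1) →ₗ[R] R) :=
    { toFun := fun a => Submodule.liftQ _ (LinearMap.toSpanSingleton R R a) (by
        rw [pow_one]
        exact fun j hj => hJ a j hj)
      map_add' := fun a b => Submodule.linearMap_qext _ (LinearMap.ext_ring
        (smul_add (1 : R) (a : R) (b : R)))
      map_smul' := fun a b => Submodule.linearMap_qext _ (LinearMap.ext_ring
        (smul_comm (1 : R) a (b : R))) }
  have hφ : Function.Injective φ := by
    intro a b hab
    have e : (1 : R) • (a : R) = (1 : R) • (b : R) :=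
      LinearMap.congr_fun hab (Submodule.Quotient.mk 1)
    rw [one_smul, one_smul] at e
    exact Subtype.ext e
  refine Module.length_le_of_injective ((g ∘ₗ φ).codRestrict _ fun a => ?_)
    (fun a b hab => hφ (hg (congrArg Subtype.val hab)))
  rw [Submodule.mem_torsionBySet_iff]
  rintro ⟨j, hj⟩
  have h0 : j • a = 0 := Subtype.ext (hJ a j hj)
  exact ((g ∘ₗ φ).map_smul j a).symm.trans ((congrArg (g ∘ₗ φ) h0).trans (map_zero (g ∘ₗ φ)))

lemma length_colonImage_le_localCohomology (h : ∀ n a, x ^ n * a = 0 → x * a = 0) (hx : x ∈ J)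
    (n : ℕ) {t : ℕ} (ht : J ^ t ≤ Ideal.span {x ^ (n + 1)}) :
    Module.length R (colonImage J x (x ^ n)) ≤
      Module.length R ↥(Submodule.torsionBySet R
        ↥((localCohomology J 1).obj (ModuleCat.of R R)) (J : Set R)) := by
  obtain ⟨g, hg0, hg⟩ := exists_localCohomology_one J t R
  choose b hb using fun s : ↥(J ^ t) => Ideal.mem_span_singleton'.1 (ht s.2)
  have hwd : ∀ (s : ↥(J ^ t)) (c : R), (s : R) = x ^ (n + 1) * c → x * b s = x * c := by
    intro s c hs
    rw [← sub_eq_zero, ← mul_sub]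
    refine h (n + 1) _ ?_
    rw [mul_sub, ← hs, ← hb s]
    ring
  let θ : ↥(J ^ t) →ₗ[R] R :=
    { toFun := fun s => x * b s
      map_add' := fun s s' => by
        rw [hwd (s + s') (b s + b s'), mul_add]
        rw [Submodule.coe_add, ← hb s, ← hb s']
        ring
      map_smul' := fun r s => by
        rw [hwd (r • s) (r * b s), RingHom.id_apply, smul_eq_mul]
        · ring
        · rw [Submodule.coe_smul, ← hb s, smul_eq_mul]
          ring }
  have hθ : ∀ (s : ↥(J ^ t)) (c : R), (s : R) = x ^ (n + 1) * c → θ s = x * c := hwd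
  let k : R →ₗ[R] ↥((localCohomology J 1).obj (ModuleCat.of R R)) :=
    g ∘ₗ LinearMap.toSpanSingleton R _ θ
  have hk0 : ∀ c, k (x ^ n * c) = 0 := by
    intro c
    have : (x ^ n * c) • θ = LinearMap.mulLeft R c ∘ₗ (J ^ t).subtype := by
      ext s
      have hs := hb s
      rw [LinearMap.smul_apply, hθ s (b s) (by rw [← hs]; ring)]
      simp only [LinearMap.comp_apply, Submodule.subtype_apply, LinearMap.mulLeft_apply,
        smul_eq_mul]
      rw [← hs]
      ring
    exact (congrArg g this).trans (hg0 _)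
  have hker : ∀ a, k a = 0 → a ∈ Ideal.span {x ^ n} ⊔ Ideal.ann x := by
    intro a ha
    obtain ⟨t', hle, ψ, hψ⟩ := hg (a • θ) ha
    have hs : x ^ (t' + (n + 1)) ∈ J ^ t' := by
      rw [pow_add]
      exact Ideal.mul_mem_right _ _ (Ideal.pow_mem_pow hx _)
    have e := LinearMap.congr_fun hψ ⟨_, hs⟩
    have e' : a * θ ⟨_, hle hs⟩ = ψ (x ^ (t' + (n + 1))) := e
    rw [hθ _ (x ^ t') (by ring), ← mul_one (x ^ (t' + (n + 1))), ← smul_eq_mul (_ ^ _) (1 : R),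
      map_smul, smul_eq_mul] at e'
    have hW := h (t' + 1) (a - x ^ n * ψ 1) (by
      rw [← sub_eq_zero] at e'
      rw [← e']
      ring)
    rw [show a = ψ 1 * x ^ n + (a - x ^ n * ψ 1) by ring]
    exact add_mem (Ideal.mem_sup_left (Ideal.mem_span_singleton'.2 ⟨_, rfl⟩))
      (Ideal.mem_sup_right (Ideal.mem_ann.2 hW))
  let C := (Ideal.span {x ^ n}).colon (J : Set R)
  have e1 : colonImage J x (x ^ n) = LinearMap.range
      ((Submodule.mkQ (Ideal.span {x ^ n} ⊔ Ideal.ann x)) ∘ₗ C.subtype) := by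
    rw [LinearMap.range_comp, Submodule.range_subtype]
  rw [e1]
  refine (LinearMap.length_range_le_of_ker_le _ (k ∘ₗ C.subtype) fun a ha => ?_).trans
    (Submodule.length_mono ?_)
  · exact (Submodule.Quotient.mk_eq_zero _).2 (hker a ha)
  · rintro _ ⟨a, rfl⟩
    rw [Submodule.mem_torsionBySet_iff]
    rintro ⟨j, hj⟩
    obtain ⟨c, hc⟩ := Ideal.mem_span_singleton'.1 (Submodule.mem_colon.1 a.2 j hj)
    have e2 : j * (a : R) = x ^ n * c := by
      rw [mul_comm, mul_comm _ c]
      exact hc.symm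
    exact (k.map_smul j a).symm.trans ((congrArg k e2).trans (hk0 c))

lemma mul_eq_zero_of_smul_localCohomology_eq_zero {M : Type} [AddCommGroup M] [Module R M]
    (h : ∀ v : (localCohomology J 0).obj (ModuleCat.of R M), x • v = 0) {t : ℕ} {m : M}
    (hm : ∀ j ∈ J ^ t, j • m = 0) : x • m = 0 := by
  obtain ⟨g, hg⟩ := exists_localCohomology_zero J t M
  let φ : (R ⧸ J ^ t) →ₗ[R] M := Submodule.liftQ _ (LinearMap.toSpanSingleton R M m) hm
  have h0 : x • φ = 0 := hg ((g.map_smul x φ).trans ((h _).trans (map_zero g).symm))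
  have e : x • (1 : R) • m = 0 := LinearMap.congr_fun h0 (Submodule.Quotient.mk 1)
  rwa [one_smul] at e

end ColonPowers

section Lengths

lemma moduleLength_eq (A M : Type) [CommRing A] [AddCommGroup M] [Module A M] :
    moduleLength A M = (Module.length A M : WithBot ℕ∞) :=
  (Module.coe_length A M).symm

lemma length_eq_of_moduleLength_eq {A M : Type} [CommRing A] [AddCommGroup M] [Module A M] {L : ℕ}
    (h : moduleLength A M = (L : ℕ∞)) : Module.length A M = L :=
  WithBot.coe_injective ((moduleLength_eq A M).symm.trans h)

/-- Comparison of the Hilbert polynomials of two filtrations whose lengths differ by constants. -/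
lemma hilbertCoeff_sub_eq {a₀ a₁ b₀ b₁ C E : ℤ} {u v : ℕ → ℤ} {N : ℕ}
    (hu : ∀ n ≥ N, u n = a₀ * (n + 1) - a₁) (hv : ∀ n ≥ N, v n = b₀ * (n + 1) - b₁)
    (hv' : ∀ n ≥ N, v (n + 1) = E + v n) (huv : ∀ n ≥ N, u (n + 1) = C + v n) :
    a₁ - b₁ = E - C := by
  have h1 := hu (N + 1) (by omega)
  have h2 := hu (N + 2) (by omega)
  have h3 := hv N le_rfl
  have h4 := hv (N + 1) (by omega)
  have h5 := huv N le_rfl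
  have h6 := huv (N + 1) (by omega)
  have h7 := hv' N le_rfl
  push_cast at *
  have h8 : a₀ = E := by linarith
  have h9 : b₀ = E := by linarith
  subst h8
  subst h9
  linarith

end Lengths

end Preliminaries

/-- Lemma 4.1: let `R` be a Noetherian local ring of dimension one with infinite residue
field and `𝔮 = (x)` a standard parameter ideal with `I² = 𝔮I`, where `I = 𝔮 :_R 𝔪`, and
`𝒩(𝔮;R) = r₀(R) + r₁(R)`. Then `e₁(I) - e₁(𝔮) = f₀(𝔮) - r₀(R)`,
where `r₀(R) = ℓ_R((0) :_R 𝔪)`. -/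
theorem stmt_11 [IsNoetherianRing R]
    (hdim : ringKrullDim R = (1 : WithBot ℕ∞))
    (hres : Infinite (ResidueField R))
    (x : R) (hstd : IsStandardSOP R 1 (fun _ : Fin 1 => x))
    (q : Ideal R) (hq : q = Ideal.span (Set.range fun _ : Fin 1 => x))
    (hqI : (q.colon (maximalIdeal R)) ^ 2 = q * (q.colon (maximalIdeal R)))
    (hN : indexOfReducibility R q = socLocalCohomology R 0 + socLocalCohomology R 1) :
    ∀ eI eQ f : ℕ → ℤ, IsHilbertCoeffs R 1 (q.colon (maximalIdeal R)) eI →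
      IsHilbertCoeffs R 1 q eQ → IsIrrCoeffs R 1 q f →
      ∀ r₀ : ℕ, moduleLength R ↥((⊥ : Ideal R).colon (maximalIdeal R)) = (r₀ : ℕ∞) →
        eI 1 - eQ 1 = f 0 - (r₀ : ℤ) := by
  intro eI eQ f hI hQ hf r₀ hr₀
  have hqx : q = Ideal.span {x} := by rw [hq, Set.range_const]
  subst hqx
  clear hq
  obtain ⟨hrad, hstd⟩ := hstd
  rw [Set.range_const] at hrad hstd
  have hxm : x ∈ maximalIdeal R :=
    hrad ▸ Ideal.le_radical (Ideal.mem_span_singleton_self x)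
  have hpow : ∀ n : ℕ, ∃ t, maximalIdeal R ^ t ≤ Ideal.span {x ^ n} := fun n => by
    refine Ideal.exists_pow_le_of_le_radical_of_fg ?_ (IsNoetherian.noetherian _)
    rw [← hrad, ← Ideal.span_singleton_pow]
    exact Ideal.radical_le_radical_iff.2 fun y hy =>
      ⟨n, Ideal.pow_mem_pow hy n⟩
  have hann : ∀ n a, x ^ n * a = 0 → x * a = 0 := by
    intro n a ha
    obtain ⟨t, ht⟩ := hpow n
    have h0 := mul_eq_zero_of_smul_localCohomology_eq_zero (t := t)
      (m := (Submodule.Quotient.mk a : R ⧸ Ideal.span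
        ((fun _ : Fin 1 => x) '' {k : Fin 1 | (k : ℕ) < 0})))
      (hstd 0 0 one_pos x (Ideal.mem_span_singleton_self x)) (fun j hj => by
        obtain ⟨b, rfl⟩ := Ideal.mem_span_singleton'.1 (ht hj)
        rw [← Submodule.Quotient.mk_smul, smul_eq_mul, mul_assoc, ha, mul_zero]
        rfl)
    rw [← Submodule.Quotient.mk_smul, Submodule.Quotient.mk_eq_zero, smul_eq_mul] at h0
    simpa using h0
  set m := maximalIdeal R with hm
  set I := (Ideal.span {x}).colon (m : Set R) with hIdef
  let r := Module.length R ↥((⊥ : Ideal R).colon (m : Set R))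
  have hr : r = r₀ := length_eq_of_moduleLength_eq hr₀
  have hidx : ∀ n ≥ 1, indexOfReducibility R (Ideal.span {x ^ n}) =
      ((r + Module.length R (colonImage m x (x ^ n)) : ℕ∞) : WithBot ℕ∞) := fun n hn => by
    rw [indexOfReducibility, moduleLength_eq,
      length_colon_quotient hxm (disjoint_span_pow_ann hann hn)]
  have hidx1 := hidx 1 le_rfl
  rw [pow_one] at hidx1
  rw [hidx1, socLocalCohomology, socLocalCohomology, moduleLength_eq, moduleLength_eq] at hN
  have hN' := WithBot.coe_injective hN
  have hD : (r + Module.length R (colonImage m x x) : ℕ∞) = ((f 0).toNat : ℕ∞) ∧ 0 ≤ f 0 := by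
    obtain ⟨N, hN⟩ := hf
    obtain ⟨L, hL, hLf⟩ := hN (N + 1) (by omega)
    have hLf' : (L : ℤ) = f 0 := by simpa using hLf
    rw [Ideal.span_singleton_pow, hidx (N + 1) (by omega)] at hL
    have hL' : r + Module.length R (colonImage m x (x ^ (N + 1))) = (L : ℕ∞) :=
      WithBot.coe_injective hL
    obtain ⟨t, ht⟩ := hpow (N + 1 + 1)
    have hle := length_colonImage_le_localCohomology hann hxm (N + 1) ht
    refine ⟨?_, hLf' ▸ Int.natCast_nonneg L⟩
    rw [← hLf', Int.toNat_natCast, ← hL']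
    refine le_antisymm (add_le_add_right (length_colonImage_le hann N) _) ?_
    rw [hN']
    exact add_le_add (length_socle_le m) hle
  obtain ⟨hD, hf0⟩ := hD
  have hquot : ∀ K : Ideal R, ∀ n ≥ 1, Module.length R (R ⧸ Ideal.span {x ^ n} * K) =
      Module.length R (R ⧸ K ⊔ Ideal.ann x) + Module.length R (R ⧸ Ideal.span {x ^ n}) :=
    fun K n hn => by rw [Ideal.length_quotient_span_singleton_mul, ann_pow_eq hann hn]
  have hIpow : ∀ n, I ^ (n + 1) = Ideal.span {x ^ n} * I := fun n => by
    induction n with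
    | zero => simp
    | succ n ih =>
      rw [pow_succ, ih, mul_assoc, ← pow_two, hqI, ← mul_assoc, pow_succ x,
        ← Ideal.span_singleton_mul_span_singleton]
  have hED := Submodule.length_quotient_eq_add (Ideal.span {x} ⊔ Ideal.ann x) I
  have hIsup : I ⊔ (Ideal.span {x} ⊔ Ideal.ann x) = I ⊔ Ideal.ann x := by
    rw [← sup_assoc, sup_eq_left.2 (Ideal.le_colon : Ideal.span {x} ≤ I)]
  rw [hIsup] at hED
  have hsum : ∀ (e : ℕ → ℤ) (n : ℕ), ∑ i ∈ Finset.range (1 + 1),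
      (-1 : ℤ) ^ i * e i * ((n + 1 - i).choose (1 - i) : ℤ) = e 0 * (n + 1) - e 1 := fun e n => by
    simp [Finset.sum_range_succ]
    ring
  obtain ⟨N₁, hI⟩ := hI
  obtain ⟨N₂, hQ⟩ := hQ
  have hu : ∀ n ≥ N₁ + N₂, ∃ L : ℕ, Module.length R (R ⧸ I ^ (n + 1)) = L ∧
      (L : ℤ) = eI 0 * (n + 1) - eI 1 := fun n hn => by
    obtain ⟨L, hL, hL'⟩ := hI n (by omega)
    exact ⟨L, length_eq_of_moduleLength_eq hL, hL'.trans (hsum _ _)⟩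
  have hv : ∀ n ≥ N₁ + N₂, ∃ L : ℕ, Module.length R (R ⧸ Ideal.span {x ^ (n + 1)}) = L ∧
      (L : ℤ) = eQ 0 * (n + 1) - eQ 1 := fun n hn => by
    obtain ⟨L, hL, hL'⟩ := hQ n (by omega)
    rw [Ideal.span_singleton_pow] at hL
    exact ⟨L, length_eq_of_moduleLength_eq hL, hL'.trans (hsum _ _)⟩
  have huv : ∀ n, Module.length R (R ⧸ I ^ (n + 1 + 1)) = Module.length R (R ⧸ I ⊔ Ideal.ann x) +
      Module.length R (R ⧸ Ideal.span {x ^ (n + 1)}) := fun n => by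
    rw [hIpow, hquot I (n + 1) (by omega)]
  have hvv : ∀ n, Module.length R (R ⧸ Ideal.span {x ^ (n + 1 + 1)}) =
      Module.length R (R ⧸ Ideal.span {x} ⊔ Ideal.ann x) +
      Module.length R (R ⧸ Ideal.span {x ^ (n + 1)}) := fun n => by
    rw [pow_succ x (n + 1), ← Ideal.span_singleton_mul_span_singleton, hquot _ (n + 1) (by omega)]
  obtain ⟨E, hE⟩ : ∃ E : ℕ, Module.length R (R ⧸ Ideal.span {x} ⊔ Ideal.ann x) = E := by
    obtain ⟨L, hL, -⟩ := hv (N₁ + N₂ + 1) (by omega)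
    exact (ENat.ne_top_iff_exists.1 (ne_top_of_le_ne_top (ENat.natCast_ne_top L)
      (le_self_add.trans ((hvv (N₁ + N₂)).symm.trans hL).le))).imp fun _ h => h.symm
  rw [hE] at hED hvv
  obtain ⟨C, hC⟩ : ∃ C : ℕ, Module.length R (R ⧸ I ⊔ Ideal.ann x) = C :=
    (ENat.ne_top_iff_exists.1 (ne_top_of_le_ne_top (ENat.natCast_ne_top E)
      (le_add_self.trans hED.symm.le))).imp fun _ h => h.symm
  obtain ⟨D, hD'⟩ : ∃ D : ℕ, Module.length R (colonImage m x x) = D :=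
    (ENat.ne_top_iff_exists.1 (ne_top_of_le_ne_top (ENat.natCast_ne_top E)
      (le_self_add.trans hED.symm.le))).imp fun _ h => h.symm
  have hED' : (E : ℕ∞) = Module.length R (colonImage m x x) + C := by rw [hED, hC]
  rw [hD'] at hED' hD
  rw [hC] at huv
  rw [hr] at hD
  norm_cast at hD hED'
  choose! u hu hu' using hu
  choose! v hv hv' using hv
  have key := hilbertCoeff_sub_eq (C := C) (E := E) (N := N₁ + N₂) hu' hv'
    (fun n hn => by
      have := hvv n
      rw [hv n hn, hv (n + 1) (by omega)] at this
      exact_mod_cast this)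
    (fun n hn => by
      have := huv n
      rw [hv n hn, hu (n + 1) (by omega)] at this
      exact_mod_cast this)
  omega

end
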